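/- Let (S, 𝔐) be a complete regular local ring of characteristic p, let E_S be the injective envelope of the residue field S/𝔐, let 𝔅 be a proper nonzero ideal of S, and let n ≥ 1. Let K_n denote the image of the natural map S^{(n)} ⊗_S (0 :_{E_S} 𝔅) → S^{(n)} ⊗_S E_S induced by the inclusion (0 :_{E_S} 𝔅) ⊆ E_S. Then: (i) the annihilator of K_n in S is 𝔅^{[p^n]}; and (ii) the annihilator of the S-submodule 𝔅·K_n in S is the colon ideal (𝔅^{[p^n]} : 𝔅). -/

import Mathlib

open TensorProduct IsLocalRing DirectSum

universe u v

/-! ### Frobenius twists and base change -/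

/-- `R` viewed as an algebra over itself via the `n`-th power of the Frobenius
endomorphism; this plays the role of `R^{(n)}` (an `R`-module via `r • s = r ^ p ^ n * s`). -/
def FrobAlg (R : Type u) (p n : ℕ) [CommRing R] [Fact p.Prime] [CharP R p] : Type u := R

namespace FrobAlg

variable (R : Type u) (p n : ℕ) [CommRing R] [Fact p.Prime] [CharP R p]

instance : CommRing (FrobAlg R p n) := inferInstanceAs (CommRing R)

instance : Algebra R (FrobAlg R p n) :=
  RingHom.toAlgebra (show R →+* FrobAlg R p n from (frobenius R p) ^ n)

/-- The canonical identification of `R` with the underlying set of `R^{(n)}`. -/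
def of (r : R) : FrobAlg R p n := r

end FrobAlg

/-- The Frobenius base change `R^{(n)} ⊗_R M` of an `R`-module `M` along the `n`-th
power of the Frobenius endomorphism of `R`. -/
def FrobBC (R : Type u) (p n : ℕ) [CommRing R] [Fact p.Prime] [CharP R p]
    (M : Type v) [AddCommGroup M] [Module R M] : Type (max u v) :=
  FrobAlg R p n ⊗[R] M

namespace FrobBC

variable (R : Type u) (p n : ℕ) [CommRing R] [Fact p.Prime] [CharP R p]
  (M : Type v) [AddCommGroup M] [Module R M]

noncomputable instance : AddCommGroup (FrobBC R p n M) :=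
  inferInstanceAs (AddCommGroup (FrobAlg R p n ⊗[R] M))

/-- The `R`-module structure on `R^{(n)} ⊗_R M` given by multiplication on the first
factor. -/
noncomputable instance : Module R (FrobBC R p n M) :=
  inferInstanceAs (Module (FrobAlg R p n) (FrobAlg R p n ⊗[R] M))

variable {M}

/-- The elementary tensor `r ⊗ m` in `R^{(n)} ⊗_R M`. -/
noncomputable def tmul (r : R) (m : M) : FrobBC R p n M := FrobAlg.of R p n r ⊗ₜ[R] m

end FrobBC

/-- `R` is `F`-pure if for every `R`-module `M` the natural map
`M → R^{(1)} ⊗_R M`, `m ↦ 1 ⊗ m`, is injective. -/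
def IsFPure (R : Type u) (p : ℕ) [CommRing R] [Fact p.Prime] [CharP R p] : Prop :=
  ∀ (M : Type u) [AddCommGroup M] [Module R M],
    Function.Injective fun m : M => FrobBC.tmul R p 1 (1 : R) m

/-- An ideal `𝔞` of `R` is fully `Φ(E)`-special if for every `n ≥ 1`, every `r ∈ 𝔞` and
every `e ∈ (0 :_E 𝔞)`, the element `r ⊗ e` is zero in `R^{(n)} ⊗_R E`. -/
def IsFullyPhiSpecial (R : Type u) (p : ℕ) [CommRing R] [Fact p.Prime] [CharP R p]
    (E : Type v) [AddCommGroup E] [Module R E] (𝔞 : Ideal R) : Prop :=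
  ∀ n : ℕ, 1 ≤ n → ∀ r ∈ 𝔞, ∀ e : E, (∀ a ∈ 𝔞, a • e = 0) → FrobBC.tmul R p n r e = 0

/-! ### The module `Φ(E)` and the Frobenius shift -/

/-- The Frobenius `a ↦ a ^ p`, as an `R`-algebra map `R^{(n)} → R^{(n+1)}`. -/
def frobStepAlg (R : Type u) (p n : ℕ) [CommRing R] [Fact p.Prime] [CharP R p] :
    FrobAlg R p n →ₐ[R] FrobAlg R p (n + 1) :=
  { (show FrobAlg R p n →+* FrobAlg R p (n + 1) from frobenius R p) with
    commutes' := fun r => by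
      show frobenius R p (((frobenius R p) ^ n) r) = ((frobenius R p) ^ (n + 1)) r
      rw [pow_succ']
      rfl }

/-- The Frobenius `a ↦ a ^ p`, as an `R`-linear map `R^{(n)} → R^{(n+1)}`. -/
def frobStep (R : Type u) (p n : ℕ) [CommRing R] [Fact p.Prime] [CharP R p] :
    FrobAlg R p n →ₗ[R] FrobAlg R p (n + 1) :=
  (frobStepAlg R p n).toLinearMap

/-- The graded module `Φ(E) = ⊕_{n ≥ 0} R^{(n)} ⊗_R E`. -/
def PhiModule (R : Type u) (p : ℕ) [CommRing R] [Fact p.Prime] [CharP R p]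
    (E : Type v) [AddCommGroup E] [Module R E] : Type (max u v) :=
  ⨁ n : ℕ, FrobBC R p n E

namespace PhiModule

variable (R : Type u) (p : ℕ) [CommRing R] [Fact p.Prime] [CharP R p]
  (E : Type v) [AddCommGroup E] [Module R E]

noncomputable instance : AddCommGroup (PhiModule R p E) :=
  inferInstanceAs (AddCommGroup (⨁ n : ℕ, FrobBC R p n E))

noncomputable instance : Module R (PhiModule R p E) :=
  inferInstanceAs (Module R (⨁ n : ℕ, FrobBC R p n E))

/-- The inclusion of the `n`-th component into `Φ(E)`. -/
noncomputable def of (n : ℕ) (g : FrobBC R p n E) : PhiModule R p E :=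
  DirectSum.of (fun m : ℕ => FrobBC R p m E) n g

/-- The Frobenius-semilinear shift operator `x` on `Φ(E)`, sending an element
`r ⊗ e` of the `n`-th component to `r ^ p ⊗ e` in the `(n+1)`-th component. -/
noncomputable def shift : PhiModule R p E →+ PhiModule R p E :=
  DirectSum.toAddMonoid fun n =>
    (DirectSum.of (fun m : ℕ => FrobBC R p m E) (n + 1)).comp
      (TensorProduct.map (frobStep R p n) (LinearMap.id (R := R) (M := E))).toAddMonoidHom

end PhiModule

/-- An ideal `𝔞` of `R` is `Φ(E)`-special if it is the annihilator of an
`R[x,f]`-submodule of `Φ(E)`, i.e. of an `R`-submodule stable under the shift operator. -/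
def IsPhiSpecial (R : Type u) (p : ℕ) [CommRing R] [Fact p.Prime] [CharP R p]
    (E : Type v) [AddCommGroup E] [Module R E] (𝔞 : Ideal R) : Prop :=
  ∃ N : Submodule R (PhiModule R p E),
    (∀ g ∈ N, PhiModule.shift R p E g ∈ N) ∧ 𝔞 = N.annihilator

/-! ### Further notions -/

/-- The `q`-th bracket (Frobenius) power `I^{[q]}` of an ideal: the ideal generated by
the `q`-th powers of the elements of `I`. -/
def Ideal.bracketPow {S : Type u} [CommRing S] (I : Ideal S) (q : ℕ) : Ideal S :=
  Ideal.span ((fun x => x ^ q) '' (I : Set S))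

/-- A Noetherian local ring is regular if its maximal ideal can be generated by
`dim S` elements. -/
def IsRegularLocal (S : Type u) [CommRing S] [IsLocalRing S] : Prop :=
  ∃ s : Finset S, (s.card : WithBot (WithTop ℕ)) = ringKrullDim S ∧
    Ideal.span (s : Set S) = maximalIdeal S

/-- An ideal `𝔟` of `R` is uniformly `F`-compatible if for every `n ≥ 1` and every
`R`-linear map `φ : R^{(n)} → R` one has `φ(𝔟) ⊆ 𝔟`. -/
def UniformlyFCompatible (R : Type u) (p : ℕ) [CommRing R] [Fact p.Prime] [CharP R p]
    (𝔟 : Ideal R) : Prop :=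
  ∀ n : ℕ, 1 ≤ n → ∀ φ : FrobAlg R p n →ₗ[R] R, ∀ b ∈ 𝔟, φ (FrobAlg.of R p n b) ∈ 𝔟

/-- `R` is `F`-finite if `R^{(1)}` is a finitely generated `R`-module. -/
def IsFFinite (R : Type u) (p : ℕ) [CommRing R] [Fact p.Prime] [CharP R p] : Prop :=
  Module.Finite R (FrobAlg R p 1)

/-- A Noetherian local ring `T` of characteristic `p` is strongly `F`-regular in the
sense of Lyubeznik and Smith if the tight closure of `0` in the injective envelope of
the residue field of `T` is zero. -/
def IsStronglyFRegularLS (T : Type u) (p : ℕ) [CommRing T] [IsLocalRing T]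
    [Fact p.Prime] [CharP T p] : Prop :=
  ∀ (ET : Type u) [AddCommGroup ET] [Module T ET],
    Module.Injective T ET →
    ∀ ι : (T ⧸ maximalIdeal T) →ₗ[T] ET, Function.Injective ι →
    (∀ N : Submodule T ET, N ⊓ LinearMap.range ι = ⊥ → N = ⊥) →
    ∀ m : ET,
      (∃ c : T, (∀ P ∈ minimalPrimes T, c ∉ P) ∧
        ∃ N₀ : ℕ, ∀ n : ℕ, N₀ ≤ n → FrobBC.tmul T p n c m = 0) → m = 0

/-- `Q` is a minimal primary decomposition of the ideal `𝔄`: the `Q i` are primary,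
`𝔄` is their intersection, their radicals are pairwise distinct, and none of them
contains the intersection of the others. -/
def IsMinimalPrimaryDecomposition {S : Type u} [CommRing S] (𝔄 : Ideal S) {t : ℕ}
    (Q : Fin t → Ideal S) : Prop :=
  𝔄 = ⨅ i, Q i ∧ (∀ i, (Q i).IsPrimary) ∧
    (Function.Injective fun i => (Q i).radical) ∧
    ∀ i, ¬ (⨅ j, ⨅ (_ : j ≠ i), Q j) ≤ Q i

section

open RingTheory.Sequence

universe w

lemma IsLocalRing.ringKrullDim_le_length {R : Type u} [CommRing R] [IsNoetherianRing R]
    [IsLocalRing R] (xs : List R) (hxs : Ideal.ofList xs = maximalIdeal R) :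
    ringKrullDim R ≤ xs.length := by
  classical
  have h1 : (maximalIdeal R).spanFinrank ≤ xs.length := by
    rw [← hxs]
    refine (Submodule.spanFinrank_span_le_ncard_of_finite (s := {x | x ∈ xs})
      (List.finite_toSet xs)).trans ?_
    have : ({x | x ∈ xs} : Set R) = (xs.toFinset : Set R) := by ext; simp
    rw [this, Set.ncard_coe_finset]
    exact List.toFinset_card_le xs
  exact (ringKrullDim_le_spanFinrank_maximalIdeal R).trans (by exact_mod_cast h1)

lemma IsLocalRing.ofList_map_quotient_mk {R : Type u} [CommRing R] [IsLocalRing R] {a : R}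
    {l : List R} [IsLocalRing (R ⧸ Ideal.span {a})] (h : Ideal.ofList (a :: l) = maximalIdeal R) :
    Ideal.ofList (l.map (Ideal.Quotient.mk (Ideal.span {a}))) =
      maximalIdeal (R ⧸ Ideal.span {a}) := by
  rw [← Ideal.map_ofList, ← map_maximalIdeal_of_surjective _ Ideal.Quotient.mk_surjective,
    ← h, Ideal.ofList_cons, Ideal.map_sup, Ideal.map_quotient_self, bot_sup_eq]

lemma IsLocalRing.mem_maximalIdeal_of_ofList_eq {R : Type u} [CommRing R] [IsLocalRing R]
    {xs : List R} (h : Ideal.ofList xs = maximalIdeal R) {x : R} (hx : x ∈ xs) :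
    x ∈ maximalIdeal R :=
  h ▸ Ideal.subset_span hx

lemma IsLocalRing.quotient_span_singleton_of_mem {R : Type u} [CommRing R] [IsLocalRing R] {a : R}
    (ha : a ∈ maximalIdeal R) : IsLocalRing (R ⧸ Ideal.span {a}) :=
  have : Nontrivial (R ⧸ Ideal.span {a}) := Ideal.Quotient.nontrivial_iff.mpr <|
    ne_top_of_le_ne_top Ideal.IsPrime.ne_top' ((Ideal.span_singleton_le_iff_mem _).mpr ha)
  .of_surjective' _ Ideal.Quotient.mk_surjective

open Pointwise in
lemma IsLocalRing.ringKrullDim_quotient_span_singleton_eq {R : Type u} [CommRing R]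
    [IsNoetherianRing R] [IsLocalRing R] {a : R} {l : List R}
    (h : Ideal.ofList (a :: l) = maximalIdeal R) (hd : ringKrullDim R = ((a :: l).length : ℕ)) :
    ringKrullDim (R ⧸ Ideal.span {a}) = (l.length : ℕ) := by
  have ha : a ∈ maximalIdeal R := mem_maximalIdeal_of_ofList_eq h (by simp)
  have := quotient_span_singleton_of_mem ha
  refine le_antisymm (by simpa using ringKrullDim_le_length _ (ofList_map_quotient_mk h)) ?_
  have h1 := ringKrullDim_le_ringKrullDim_quotSMulTop_succ ha
  have e : (a • (⊤ : Ideal R)) = Ideal.span {a} := by simp [← Submodule.ideal_span_singleton_smul]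
  rw [hd, e, List.length_cons] at h1
  push_cast at h1
  exact ENat.WithBot.add_le_add_one_right_iff.mp h1

lemma IsLocalRing.not_ofList_le_of_length_lt {R : Type u} [CommRing R] [IsNoetherianRing R]
    [IsLocalRing R] {xs ys : List R} (hxs : Ideal.ofList xs = maximalIdeal R)
    (hd : ringKrullDim R = (xs.length : ℕ)) (hys : ∀ y ∈ ys, y ∈ maximalIdeal R)
    (hlt : ys.length < xs.length) : ∃ x ∈ xs, x ∉ Ideal.ofList ys := by
  by_contra! hc
  have h1 : Ideal.ofList ys = maximalIdeal R :=
    le_antisymm (Ideal.span_le.mpr hys) (hxs ▸ Ideal.span_le.mpr hc)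
  have := ringKrullDim_le_length ys h1
  rw [hd] at this
  exact absurd (by exact_mod_cast this) hlt.not_ge

lemma isDomain_of_isPrime_span_singleton {R : Type u} [CommRing R] [IsNoetherianRing R]
    [IsLocalRing R] {b : R} (hb : (Ideal.span {b}).IsPrime)
    (hmin : Ideal.span {b} ∉ minimalPrimes R) : IsDomain R := by
  obtain ⟨Q, hQ, hQb⟩ := Ideal.exists_minimalPrimes_le (bot_le : ⊥ ≤ Ideal.span {b})
  have hQp : Q.IsPrime := hQ.1.1
  have hbQ : b ∉ Q := fun h ↦ hmin <| by
    rwa [le_antisymm ((Ideal.span_singleton_le_iff_mem _).mpr h) hQb]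
  have hle : Q ≤ Ideal.span {b} • Q := fun q hq ↦ by
    obtain ⟨r, rfl⟩ := Ideal.mem_span_singleton'.mp (hQb hq)
    rw [mul_comm]
    exact Submodule.smul_mem_smul (Ideal.mem_span_singleton_self b)
      ((hQp.mem_or_mem hq).resolve_right hbQ)
  have : Q = ⊥ := Submodule.eq_bot_of_le_smul_of_le_jacobson_bot _ _ (IsNoetherian.noetherian Q)
    hle ((le_maximalIdeal hb.ne_top).trans (maximalIdeal_le_jacobson _))
  subst this
  exact IsDomain.of_bot_isPrime R

lemma IsLocalRing.exists_not_mem_minimalPrimes {R : Type u} [CommRing R] [IsNoetherianRing R]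
    [IsLocalRing R] {a : R} {l : List R} (h : Ideal.ofList (a :: l) = maximalIdeal R)
    (hd : ringKrullDim R = ((a :: l).length : ℕ))
    (hprime : ∀ b, Ideal.ofList (b :: l) = maximalIdeal R → (Ideal.span {b}).IsPrime) :
    ∃ b, Ideal.ofList (b :: l) = maximalIdeal R ∧ Ideal.span {b} ∉ minimalPrimes R := by
  by_contra! hmin
  cases l with
  | nil =>
    have h1 := hmin a h
    have h2 : maximalIdeal R ∈ minimalPrimes R := by simpa [← h] using h1
    have h3 := Ideal.height_eq_zero_iff.mpr h2
    have h4 := maximalIdeal_height_eq_ringKrullDim (R := R)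
    rw [h3, hd] at h4
    simp at h4
  | cons c l =>
    have hc : c ∈ maximalIdeal R := mem_maximalIdeal_of_ofList_eq h (by simp)
    have hgen (k : ℕ) : Ideal.ofList ((a + c ^ (k + 1)) :: c :: l) = maximalIdeal R := by
      rw [← h, Ideal.ofList_cons, Ideal.ofList_cons a]
      have hk : c ^ (k + 1) ∈ Ideal.ofList (c :: l) :=
        Ideal.pow_mem_of_mem _ (Ideal.subset_span (by simp)) _ k.succ_pos
      refine le_antisymm (sup_le ?_ le_sup_right) (sup_le ?_ le_sup_right) <;>
        rw [Ideal.span_singleton_le_iff_mem]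
      · exact add_mem (Ideal.mem_sup_left (Ideal.mem_span_singleton_self a))
          (Ideal.mem_sup_right hk)
      · have := sub_mem (Ideal.mem_sup_left (T := Ideal.ofList (c :: l))
          (Ideal.mem_span_singleton_self (a + c ^ (k + 1)))) (Ideal.mem_sup_right hk)
        rwa [add_sub_cancel_right] at this
    obtain ⟨k, m, hkm, heq⟩ := Set.Finite.exists_lt_map_eq_of_forall_mem
      (f := fun k : ℕ ↦ Ideal.span {a + c ^ (k + 1)}) (fun k ↦ hmin _ (hgen k))
      (minimalPrimes.finite_of_isNoetherianRing R)
    set P := Ideal.span {a + c ^ (k + 1)} with hP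
    have hPp : P.IsPrime := hprime _ (hgen k)
    have hk : a + c ^ (k + 1) ∈ P := Ideal.mem_span_singleton_self _
    have hm : a + c ^ (m + 1) ∈ P := heq ▸ Ideal.mem_span_singleton_self _
    have hu : IsUnit (1 - c ^ (m - k)) :=
      IsLocalRing.isUnit_one_sub_self_of_mem_nonunits _
        (Ideal.pow_mem_of_mem _ hc _ (Nat.sub_pos_of_lt hkm))
    have hcP : c ∈ P := by
      refine hPp.mem_of_pow_mem (k + 1) ?_
      rw [← Ideal.mul_unit_mem_iff_mem P hu]
      have : c ^ (k + 1) * (1 - c ^ (m - k)) = (a + c ^ (k + 1)) - (a + c ^ (m + 1)) := by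
        rw [mul_sub, ← pow_add, show k + 1 + (m - k) = m + 1 by omega]; ring
      rw [this]
      exact sub_mem hk hm
    have haP : a ∈ P := by
      have := sub_mem hk (Ideal.pow_mem_of_mem P hcP (k + 1) k.succ_pos)
      rwa [add_sub_cancel_right] at this
    obtain ⟨x, hx, hx'⟩ := not_ofList_le_of_length_lt (ys := (a + c ^ (k + 1)) :: l) h hd
      (fun y hy ↦ mem_maximalIdeal_of_ofList_eq (hgen k) (by
        simp only [List.mem_cons] at hy ⊢; tauto)) (by simp)
    rw [Ideal.ofList_cons] at hx'
    simp only [List.mem_cons] at hx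
    rcases hx with rfl | rfl | hx
    · exact hx' (Ideal.mem_sup_left haP)
    · exact hx' (Ideal.mem_sup_left hcP)
    · exact hx' (Ideal.mem_sup_right (Ideal.subset_span hx))

/-- A regular local ring is a domain. -/
theorem IsLocalRing.isDomain_of_ringKrullDim_eq_length {R : Type u} [CommRing R]
    [IsNoetherianRing R] [IsLocalRing R] (xs : List R) (hxs : Ideal.ofList xs = maximalIdeal R)
    (hd : ringKrullDim R = (xs.length : ℕ)) : IsDomain R := by
  induction hn : xs.length generalizing R with
  | zero =>
    obtain rfl := List.length_eq_zero_iff.mp hn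
    rw [Ideal.ofList_nil] at hxs
    exact (isField_iff_maximalIdeal_eq.mpr hxs.symm).isDomain
  | succ d ih =>
    match xs with
    | a :: l =>
    have hprime (b : R) (hb : Ideal.ofList (b :: l) = maximalIdeal R) :
        (Ideal.span {b}).IsPrime := by
      have := quotient_span_singleton_of_mem (mem_maximalIdeal_of_ofList_eq hb List.mem_cons_self)
      rw [← Ideal.Quotient.isDomain_iff_prime]
      exact ih _ (ofList_map_quotient_mk hb)
        (by simpa using ringKrullDim_quotient_span_singleton_eq hb hd) (by simpa using hn)
    obtain ⟨b, hb, hbmin⟩ := exists_not_mem_minimalPrimes hxs hd hprime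
    exact isDomain_of_isPrime_span_singleton (hprime b hb) hbmin

open Pointwise in
/-- A regular system of parameters is a regular sequence. -/
theorem IsLocalRing.isWeaklyRegular_of_ringKrullDim_eq_length {R : Type u} [CommRing R]
    [IsNoetherianRing R] [IsLocalRing R] (xs : List R) (hxs : Ideal.ofList xs = maximalIdeal R)
    (hd : ringKrullDim R = (xs.length : ℕ)) : IsWeaklyRegular R xs := by
  induction hn : xs.length generalizing R with
  | zero =>
    obtain rfl := List.length_eq_zero_iff.mp hn
    exact .nil R R
  | succ d ih =>
    match xs with
    | a :: l =>
    have := isDomain_of_ringKrullDim_eq_length _ hxs hd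
    have := quotient_span_singleton_of_mem (mem_maximalIdeal_of_ofList_eq hxs List.mem_cons_self)
    have ha : a ≠ 0 := by
      rintro rfl
      obtain ⟨x, hx, hx'⟩ := not_ofList_le_of_length_lt (ys := l) hxs hd
        (fun y hy ↦ mem_maximalIdeal_of_ofList_eq hxs (by simp [hy])) (by simp)
      rcases List.mem_cons.mp hx with rfl | hx
      · exact hx' (zero_mem _)
      · exact hx' (Ideal.subset_span hx)
    refine .cons (IsLeftRegular.isSMulRegular (IsRegular.of_ne_zero ha).left) ?_
    have h1 := ih _ (ofList_map_quotient_mk hxs)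
      (by simpa using ringKrullDim_quotient_span_singleton_eq hxs hd) (by simpa using hn)
    have h2 := (isWeaklyRegular_map_algebraMap_iff (R := R) (R ⧸ Ideal.span {a})
      (M := R ⧸ Ideal.span {a}) l).mp h1
    have e : (a • (⊤ : Submodule R R)) = Ideal.span {a} := by
      simp [← Submodule.ideal_span_singleton_smul]
    exact (LinearEquiv.isWeaklyRegular_congr (Submodule.quotEquivOfEq _ _ e) l).mpr h2

/-- Powers of a regular sequence in the maximal ideal form a regular sequence. -/
lemma RingTheory.Sequence.IsWeaklyRegular.map_pow_append {R M : Type*} [CommRing R]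
    [IsLocalRing R] [AddCommGroup M] [Module R M] [IsNoetherian R M] (q : ℕ) (hq : 0 < q)
    (l ys : List R) (h : IsWeaklyRegular M (l ++ ys)) (hm : ∀ r ∈ l ++ ys, r ∈ maximalIdeal R) :
    IsWeaklyRegular M (l.map (· ^ q) ++ ys) := by
  induction l generalizing ys with
  | nil => simpa using h
  | cons a l ih =>
    have hpow : ∀ r ∈ maximalIdeal R, r ^ q ∈ maximalIdeal R := fun r hr ↦
      Ideal.pow_mem_of_mem _ hr _ hq
    have h1 : IsWeaklyRegular M ((l ++ ys) ++ [a]) :=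
      isWeaklyRegular_of_perm_of_subset_maximalIdeal h
        (by simpa using (List.perm_append_singleton a (l ++ ys)).symm) hm
    have h2 : IsWeaklyRegular M ((l ++ ys) ++ [a ^ q]) := by
      rw [isWeaklyRegular_append_iff, isWeaklyRegular_singleton_iff] at h1 ⊢
      exact ⟨h1.1, h1.2.pow q⟩
    have hm' : ∀ r ∈ l ++ (ys ++ [a ^ q]), r ∈ maximalIdeal R := by
      intro r hr
      rw [← List.append_assoc, List.mem_append, List.mem_singleton] at hr
      rcases hr with hr | rfl
      · exact hm r (List.mem_cons_of_mem a hr)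
      · exact hpow a (hm a (by simp))
    have h3 := ih (ys ++ [a ^ q]) (by rwa [← List.append_assoc]) hm'
    refine isWeaklyRegular_of_perm_of_subset_maximalIdeal h3 ?_ ?_
    · rw [← List.append_assoc]
      exact List.perm_append_singleton (a ^ q) _
    · intro r hr
      rcases List.mem_append.mp hr with hr | hr
      · obtain ⟨s, hs, rfl⟩ := List.mem_map.mp hr
        exact hpow s (hm' s (by simp [hs]))
      · exact hm' r (List.mem_append_right _ hr)

open Pointwise in
/-- The degree one Koszul cohomology of the character module vanishes along a regular sequence. -/
lemma CharacterModule.exists_smul_eq_of_isWeaklyRegular {R : Type u} [CommRing R] (xs : List R)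
    {A : Type v} [AddCommGroup A] [Module R A] (h : IsWeaklyRegular A xs)
    (c : R → CharacterModule A) (hc : ∀ x ∈ xs, ∀ y ∈ xs, x • c y = y • c x) :
    ∃ d : CharacterModule A, ∀ x ∈ xs, c x = x • d := by
  induction xs generalizing A with
  | nil => simp
  | cons r l ih =>
    obtain ⟨hr, hl⟩ := (isWeaklyRegular_cons_iff A r l).mp h
    obtain ⟨d₁, hd₁⟩ := CharacterModule.dual_surjective_of_injective (LinearMap.lsmul R A r) hr (c r)
    have hd₁ : c r = r • d₁ := hd₁.symm
    let π : A →ₗ[R] QuotSMulTop r A := Submodule.mkQ _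
    have key (x : R) (hx : x ∈ l) : ∃ e, CharacterModule.dual π e = c x - x • d₁ := by
      have hker : (c x - x • d₁ : CharacterModule A) ∘ LinearMap.lsmul R A r = 0 := by
        have : r • (c x - x • d₁) = 0 := by
          rw [smul_sub, hc r (by simp) x (by simp [hx]), hd₁, smul_comm, sub_self]
        exact congrArg DFunLike.coe this
      have hle : (r • (⊤ : Submodule R A)).toAddSubgroup ≤ (c x - x • d₁ : A →+ _).ker := by
        rintro _ ⟨a, -, rfl⟩
        exact congrFun hker a
      exact ⟨QuotientAddGroup.lift _ (c x - x • d₁ : A →+ _) hle, rfl⟩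
    choose! c' hc' using key
    have hinj := CharacterModule.dual_injective_of_surjective π (Submodule.mkQ_surjective _)
    obtain ⟨d₂, hd₂⟩ := ih hl c' fun x hx y hy ↦ hinj <| by
      rw [map_smul, map_smul, hc' x hx, hc' y hy, smul_sub, smul_sub,
        hc x (by simp [hx]) y (by simp [hy]), smul_comm]
    refine ⟨d₁ + CharacterModule.dual π d₂, fun x hx ↦ ?_⟩
    rw [smul_add, ← map_smul]
    rcases List.mem_cons.mp hx with rfl | hx
    · have : CharacterModule.dual π (x • d₂) = 0 := by
        ext a
        have : x • π a = 0 := by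
          rw [← map_smul]
          exact (Submodule.Quotient.mk_eq_zero _).mpr
            (Submodule.smul_mem_pointwise_smul a x ⊤ trivial)
        change d₂ (x • π a) = 0
        rw [this, map_zero]
      rw [this, add_zero, hd₁]
    · rw [← hd₂ x hx, hc' x hx, add_sub_cancel]

/-- If linear maps from the maximal ideal to `D` extend to the ring, then linear maps to `D` extend
along embeddings into modules that are torsion with respect to the maximal ideal. -/
lemma IsLocalRing.exists_extension_of_torsion {R : Type u} [CommRing R] [IsLocalRing R]
    {D : Type v} [AddCommGroup D] [Module R D]
    (hD : ∀ g : maximalIdeal R →ₗ[R] D, ∃ d : D, ∀ x : maximalIdeal R, g x = (x : R) • d)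
    {N M : Type w} [AddCommGroup N] [Module R N] [AddCommGroup M] [Module R M]
    (hM : ∀ m : M, ∃ k : ℕ, ∀ r ∈ maximalIdeal R ^ k, r • m = 0)
    (i : N →ₗ[R] M) (hi : Function.Injective i) (f : N →ₗ[R] D) :
    ∃ g : M →ₗ[R] D, ∀ n, g (i n) = f n := by
  have : Fact (Function.Injective i) := ⟨hi⟩
  set F := Module.Baer.extensionOfMax i f with hF
  have htop : F.domain = ⊤ := by
    rw [eq_top_iff]
    have key : ∀ k : ℕ, ∀ y : M, (∀ r ∈ maximalIdeal R ^ k, r • y ∈ F.domain) → y ∈ F.domain := by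
      have step (y : M) (hy : ∀ r ∈ maximalIdeal R, r • y ∈ F.domain) : y ∈ F.domain := by
        by_contra hyF
        let g : maximalIdeal R →ₗ[R] D := F.toLinearPMap.toFun ∘ₗ
          ((LinearMap.toSpanSingleton R M y).comp (maximalIdeal R).subtype).codRestrict
            F.domain (fun r ↦ hy r r.2)
        obtain ⟨d, hd⟩ := hD g
        have hmem (r : R) (hr : r • y ∈ F.domain) : r ∈ maximalIdeal R := by
          by_contra hru
          obtain ⟨u, rfl⟩ := (notMem_maximalIdeal.mp hru)
          refine hyF ?_
          simpa [smul_smul] using F.domain.smul_mem (↑u⁻¹ : R) hr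
        have hval (r : R) (hr : r • y ∈ F.domain) : F.toLinearPMap ⟨r • y, hr⟩ = r • d :=
          hd ⟨r, hmem r hr⟩
        let G : M →ₗ.[R] D := LinearPMap.mkSpanSingleton' y d fun r hr ↦ by
          rw [RingHom.id_apply, ← hval r (hr ▸ zero_mem _)]
          have : (⟨r • y, hr ▸ zero_mem _⟩ : F.domain) = 0 := Subtype.ext hr
          rw [this, LinearPMap.map_zero]
        have hagree : ∀ (a : F.domain) (b : G.domain), (a : M) = b → F.toLinearPMap a = G b := by
          rintro ⟨a, ha⟩ ⟨b, hb⟩ (rfl : a = b)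
          obtain ⟨r, rfl⟩ := Submodule.mem_span_singleton.mp hb
          rw [hval r ha]
          exact (LinearPMap.mkSpanSingleton'_apply y d _ r hb).symm
        have hle := LinearPMap.left_le_sup F.toLinearPMap G hagree
        let F' : Module.Baer.ExtensionOf i f :=
          { F.toLinearPMap.sup G hagree with
            le := F.le.trans hle.1
            is_extension := fun m ↦ (F.is_extension m).trans (hle.2 rfl) }
        have hmax := Module.Baer.extensionOfMax_is_max i f F' hle
        have hyF' : y ∈ F'.domain :=
          (le_sup_right : G.domain ≤ F.domain ⊔ G.domain) (Submodule.mem_span_singleton_self y)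
        rw [hmax] at hyF'
        exact hyF hyF'
      intro k
      induction k with
      | zero => intro y hy; simpa using hy 1 (by simp)
      | succ k ih =>
        intro y hy
        refine ih y fun r hr ↦ step _ fun s hs ↦ ?_
        rw [smul_smul]
        exact hy _ (pow_succ' (maximalIdeal R) k ▸ Ideal.mul_mem_mul hs hr)
    intro y _
    obtain ⟨k, hk⟩ := hM y
    exact key k y fun r hr ↦ by rw [hk r hr]; exact zero_mem _
  refine ⟨F.toLinearPMap.toFun ∘ₗ (LinearMap.id.codRestrict F.domain fun m ↦ htop ▸ trivial),
    fun n ↦ ?_⟩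
  exact (F.is_extension n).symm

/-- An essential extension of the residue field is torsion with respect to the maximal ideal. -/
lemma IsLocalRing.exists_pow_smul_eq_zero_of_essential {R : Type u} [CommRing R]
    [IsNoetherianRing R] [IsLocalRing R] {E : Type v} [AddCommGroup E] [Module R E]
    (ι : (R ⧸ maximalIdeal R) →ₗ[R] E)
    (hess : ∀ N : Submodule R E, N ⊓ LinearMap.range ι = ⊥ → N = ⊥) (e : E) :
    ∃ k : ℕ, ∀ r ∈ maximalIdeal R ^ k, r • e = 0 := by
  let N : Submodule R E := Submodule.span R {e}
  obtain ⟨k, hk⟩ := (maximalIdeal R).exists_pow_inf_eq_pow_smul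
    ((LinearMap.range ι).comap N.subtype)
  have hι : ∀ r ∈ maximalIdeal R, ∀ x ∈ LinearMap.range ι, r • x = 0 := by
    rintro r hr _ ⟨z, rfl⟩
    obtain ⟨z, rfl⟩ := Ideal.Quotient.mk_surjective z
    rw [← map_smul, ← Ideal.Quotient.mk_eq_mk, ← Submodule.Quotient.mk_smul, smul_eq_mul,
      (Submodule.Quotient.mk_eq_zero _).mpr (Ideal.mul_mem_right _ _ hr), map_zero]
  have hinf : (maximalIdeal R) ^ (k + 1) • (⊤ : Submodule R N) ⊓
      (LinearMap.range ι).comap N.subtype = ⊥ := by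
    rw [hk (k + 1) k.le_succ, Nat.add_sub_cancel_left, pow_one, eq_bot_iff, Submodule.smul_le]
    intro r hr x hx
    exact Subtype.ext (hι r hr _ hx.2)
  have h1 : ((maximalIdeal R) ^ (k + 1) • (⊤ : Submodule R N)).map N.subtype = ⊥ := by
    apply hess
    rw [eq_bot_iff]
    rintro _ ⟨⟨x, hx, rfl⟩, hxι⟩
    have : x ∈ (⊥ : Submodule R N) := hinf ▸ ⟨hx, hxι⟩
    simpa using this
  refine ⟨k + 1, fun r hr ↦ ?_⟩
  have : r • e ∈ ((maximalIdeal R) ^ (k + 1) • (⊤ : Submodule R N)).map N.subtype :=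
    ⟨r • ⟨e, Submodule.mem_span_singleton_self e⟩, Submodule.smul_mem_smul hr trivial, rfl⟩
  simpa [h1] using this

/-- The injective hull of the residue field detects ideals. -/
lemma IsLocalRing.exists_smul_ne_zero_of_notMem {R : Type u} [CommRing R] [IsLocalRing R]
    {E : Type u} [AddCommGroup E] [Module R E] (hE : Module.Injective R E)
    (ι : (R ⧸ maximalIdeal R) →ₗ[R] E) (hι : Function.Injective ι) {J : Ideal R} {s : R}
    (hs : s ∉ J) : ∃ e : E, (∀ a ∈ J, a • e = 0) ∧ s • e ≠ 0 := by
  let t : R →ₗ[R] R ⧸ J := LinearMap.toSpanSingleton R _ (Submodule.Quotient.mk s)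
  have ht (r : R) : t r = 0 ↔ r * s ∈ J := by
    change r • (Submodule.Quotient.mk s : R ⧸ J) = 0 ↔ _
    rw [← Submodule.Quotient.mk_smul, Submodule.Quotient.mk_eq_zero, smul_eq_mul]
  have hle : LinearMap.ker t ≤ maximalIdeal R := by
    refine le_maximalIdeal fun h ↦ hs ?_
    have : (1 : R) ∈ LinearMap.ker t := h ▸ trivial
    simpa using (ht 1).mp this
  let j : (R ⧸ LinearMap.ker t) →ₗ[R] R ⧸ J := (LinearMap.ker t).liftQ t le_rfl
  have hj : Function.Injective j := by
    rw [← LinearMap.ker_eq_bot]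
    exact Submodule.ker_liftQ_eq_bot _ _ _ le_rfl
  obtain ⟨g, hg⟩ := hE.out j hj (ι ∘ₗ Submodule.factor hle)
  refine ⟨g (Submodule.Quotient.mk 1), fun a ha ↦ ?_, ?_⟩
  · rw [← map_smul, ← Submodule.Quotient.mk_smul, smul_eq_mul, mul_one,
      (Submodule.Quotient.mk_eq_zero _).mpr ha, map_zero]
  · rw [← map_smul, ← Submodule.Quotient.mk_smul, smul_eq_mul, mul_one]
    have h1 := hg (Submodule.Quotient.mk 1)
    have h2 : j (Submodule.Quotient.mk 1) = Submodule.Quotient.mk s := by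
      change (1 : R) • (Submodule.Quotient.mk s : R ⧸ J) = _
      rw [one_smul]
    rw [h2] at h1
    rw [h1]
    change ι (Submodule.Quotient.mk 1) ≠ 0
    rw [ne_eq, map_eq_zero_iff ι hι, Submodule.Quotient.mk_eq_zero]
    exact (Ideal.ne_top_iff_one _).mp Ideal.IsPrime.ne_top'

/-- An ideal primary to the maximal ideal is the annihilator of a finite subset of the injective
hull of the residue field. -/
lemma IsLocalRing.exists_finset_annihilator_le {R : Type u} [CommRing R] [IsNoetherianRing R]
    [IsLocalRing R] {E : Type u} [AddCommGroup E] [Module R E] (hE : Module.Injective R E)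
    (ι : (R ⧸ maximalIdeal R) →ₗ[R] E) (hι : Function.Injective ι) {J : Ideal R} {k : ℕ}
    (hJ : J ≠ ⊤) (hk : maximalIdeal R ^ k ≤ J) :
    ∃ T : Finset E, (∀ e ∈ T, ∀ a ∈ J, a • e = 0) ∧ ∀ s, (∀ e ∈ T, s • e = 0) → s ∈ J := by
  classical
  have : Nontrivial (R ⧸ J) := Ideal.Quotient.nontrivial_iff.mpr hJ
  have : IsLocalRing (R ⧸ J) := .of_surjective' _ Ideal.Quotient.mk_surjective
  have : IsArtinianRing (R ⧸ J) := by
    refine (isArtinianRing_iff_isNilpotent_maximalIdeal _).mpr ⟨k, ?_⟩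
    rw [← map_maximalIdeal_of_surjective _ Ideal.Quotient.mk_surjective, ← Ideal.map_pow]
    exact (Ideal.map_eq_bot_iff_le_ker _).mpr (by rwa [Ideal.mk_ker])
  let f (e : {e : E // ∀ a ∈ J, a • e = 0}) : Ideal (R ⧸ J) :=
    Ideal.map (Ideal.Quotient.mk J) (LinearMap.ker (LinearMap.toSpanSingleton R E e))
  have hf (e : {e : E // ∀ a ∈ J, a • e = 0}) (s : R) :
      Ideal.Quotient.mk J s ∈ f e ↔ s • e.1 = 0 := by
    have h1 : J ≤ LinearMap.ker (LinearMap.toSpanSingleton R E e) := fun a ha ↦ e.2 a ha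
    rw [← Ideal.mem_comap, Ideal.comap_map_of_surjective' _ Ideal.Quotient.mk_surjective,
      Ideal.mk_ker, sup_eq_left.mpr h1]
    rfl
  obtain ⟨T, hT⟩ := Finset.exists_inf_le f
  refine ⟨T.image Subtype.val, ?_, fun s hs ↦ ?_⟩
  · intro e he
    obtain ⟨e, -, rfl⟩ := Finset.mem_image.mp he
    exact e.2
  · by_contra hsJ
    obtain ⟨e, he, hse⟩ := exists_smul_ne_zero_of_notMem hE ι hι hsJ
    refine hse ((hf ⟨e, he⟩ s).mp (hT ⟨e, he⟩ ?_))
    exact Submodule.mem_finsetInf.mpr fun i hi ↦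
      (hf i s).mpr (hs i.1 (Finset.mem_image_of_mem _ hi))

lemma FrobAlg.algebraMap_eq {R : Type u} {p n : ℕ} [CommRing R] [Fact p.Prime] [CharP R p]
    (x : R) : algebraMap R (FrobAlg R p n) x = FrobAlg.of R p n (x ^ p ^ n) :=
  (DFunLike.congr_fun (iterateFrobenius_eq_pow R p n).symm x).trans (iterateFrobenius_def p n x)

/-- Linear maps into the character module of `R^{(n)}` extend along embeddings into modules that are
torsion with respect to the maximal ideal, when `R` is regular. -/
lemma FrobAlg.exists_extension_characterModule {R : Type u} [CommRing R] [IsNoetherianRing R]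
    [IsLocalRing R] {p : ℕ} [Fact p.Prime] [CharP R p] (hreg : IsRegularLocal R) (n : ℕ)
    {N M : Type u} [AddCommGroup N] [Module R N] [AddCommGroup M] [Module R M]
    (hM : ∀ m : M, ∃ k : ℕ, ∀ r ∈ maximalIdeal R ^ k, r • m = 0)
    (i : N →ₗ[R] M) (hi : Function.Injective i) (f : N →ₗ[R] CharacterModule (FrobAlg R p n)) :
    ∃ g : M →ₗ[R] CharacterModule (FrobAlg R p n), ∀ n, g (i n) = f n := by
  obtain ⟨s, hcard, hs⟩ := hreg
  have hxs : Ideal.ofList s.toList = maximalIdeal R := by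
    rw [← hs]; simp [Ideal.ofList]
  have hm : ∀ x ∈ s.toList, x ∈ maximalIdeal R := fun x hx ↦ mem_maximalIdeal_of_ofList_eq hxs hx
  have h1 : IsWeaklyRegular R s.toList := isWeaklyRegular_of_ringKrullDim_eq_length _ hxs
    (by rw [Finset.length_toList]; exact hcard.symm)
  have h2 : IsWeaklyRegular R (s.toList.map (· ^ p ^ n)) := by
    simpa using IsWeaklyRegular.map_pow_append (p ^ n) (pow_pos (Fact.out : p.Prime).pos n)
      s.toList [] (by simpa using h1) (by simpa using hm)
  have h3 : IsWeaklyRegular (FrobAlg R p n) s.toList := by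
    have e : s.toList.map (algebraMap R (FrobAlg R p n)) = s.toList.map (· ^ p ^ n) :=
      List.map_congr_left fun x _ ↦ FrobAlg.algebraMap_eq x
    refine (isWeaklyRegular_map_algebraMap_iff (R := R) (FrobAlg R p n)
      (M := FrobAlg R p n) s.toList).mp ?_
    rw [e]
    exact h2
  refine exists_extension_of_torsion (fun g ↦ ?_) hM i hi f
  classical
  let c (x : R) : CharacterModule (FrobAlg R p n) :=
    if hx : x ∈ maximalIdeal R then g ⟨x, hx⟩ else 0
  have hc (x : maximalIdeal R) : c x = g x := dif_pos x.2
  obtain ⟨d, hd⟩ := CharacterModule.exists_smul_eq_of_isWeaklyRegular s.toList h3 c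
    fun x hx y hy ↦ by
      rw [hc ⟨x, hm x hx⟩, hc ⟨y, hm y hy⟩, ← map_smul, ← map_smul]
      congr 1
      exact Subtype.ext (mul_comm x y)
  refine ⟨d, ?_⟩
  rintro ⟨x, hx⟩
  have hx' := hx
  rw [← hxs] at hx'
  induction hx' using Submodule.span_induction with
  | mem x h => rw [← hc]; exact hd x h
  | zero => exact (map_zero g).trans (zero_smul R d).symm
  | add x y hx' hy' ihx ihy =>
    have hxm : x ∈ maximalIdeal R := hxs ▸ hx'
    have hym : y ∈ maximalIdeal R := hxs ▸ hy'
    have := map_add g ⟨x, hxm⟩ ⟨y, hym⟩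
    rw [ihx hxm, ihy hym] at this
    exact this.trans (add_smul x y d).symm
  | smul a x hx' ihx =>
    have hxm : x ∈ maximalIdeal R := hxs ▸ hx'
    have := map_smul g a ⟨x, hxm⟩
    rw [ihx hxm] at this
    exact this.trans (mul_smul a x d).symm

namespace FrobBC

variable {R : Type u} {p n : ℕ} [CommRing R] [Fact p.Prime] [CharP R p]
  {M : Type v} [AddCommGroup M] [Module R M]

lemma smul_tmul (s r : R) (m : M) : s • tmul R p n r m = tmul R p n (s * r) m := rfl

lemma tmul_pow_mul (r b : R) (m : M) :
    tmul R p n (b ^ p ^ n * r) m = tmul R p n r (b • m) := by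
  rw [tmul, tmul, TensorProduct.tmul_smul, TensorProduct.smul_tmul', Algebra.smul_def,
    FrobAlg.algebraMap_eq]
  rfl

lemma tmul_zero (r : R) : tmul R p n r (0 : M) = 0 :=
  TensorProduct.tmul_zero M (FrobAlg.of R p n r)

lemma smul_tmul_eq_zero_of_mem_bracketPow {𝔅 : Ideal R} {e : M} (he : ∀ b ∈ 𝔅, b • e = 0) {r a : R}
    (hr : r ∈ 𝔅.bracketPow (p ^ n)) : r • tmul R p n a e = 0 := by
  induction hr using Submodule.span_induction with
  | mem x h =>
    obtain ⟨b, hb, rfl⟩ := h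
    change b ^ p ^ n • _ = _
    rw [smul_tmul, tmul_pow_mul, he b hb, tmul_zero]
  | zero => exact zero_smul _ _
  | add x y _ _ hx hy => rw [add_smul, hx, hy, add_zero]
  | smul c x _ hx => rw [smul_assoc, hx, smul_zero]

/-- A linear map to the character module of `R^{(n)}` factors through `R^{(n)} ⊗ M`. -/
lemma apply_eq_zero_of_tmul_eq_zero (g : M →ₗ[R] CharacterModule (FrobAlg R p n)) {r : R} {m : M}
    (h : tmul R p n r m = 0) : g m (FrobAlg.of R p n r) = 0 := by
  have h' : (TensorProduct.comm R (FrobAlg R p n) M) (FrobAlg.of R p n r ⊗ₜ m) = 0 :=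
    (congrArg (TensorProduct.comm R (FrobAlg R p n) M) h).trans (map_zero _)
  exact (congrArg (CharacterModule.uncurry g) h').trans (map_zero _)

end FrobBC

/-- Frobenius powers commute with annihilators on the injective hull of the residue field. -/
lemma mem_bracketPow_of_forall_tmul_eq_zero {R : Type u} [CommRing R] [IsNoetherianRing R]
    [IsLocalRing R] {p : ℕ} [Fact p.Prime] [CharP R p] (hreg : IsRegularLocal R)
    {E : Type u} [AddCommGroup E] [Module R E] (hE : Module.Injective R E)
    (ι : (R ⧸ maximalIdeal R) →ₗ[R] E) (hι : Function.Injective ι)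
    (hess : ∀ N : Submodule R E, N ⊓ LinearMap.range ι = ⊥ → N = ⊥)
    {J : Ideal R} {k : ℕ} (hJ : J ≠ ⊤) (hk : maximalIdeal R ^ k ≤ J) (n : ℕ) (r : R)
    (hr : ∀ e : E, (∀ a ∈ J, a • e = 0) → FrobBC.tmul R p n r e = 0) :
    r ∈ J.bracketPow (p ^ n) := by
  classical
  by_contra hrJ
  obtain ⟨T, hT, hTJ⟩ := exists_finset_annihilator_le hE ι hι hJ hk
  obtain ⟨ψ, hψ⟩ := CharacterModule.exists_character_apply_ne_zero_of_ne_zero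
    (mt (Ideal.Quotient.eq_zero_iff_mem (I := J.bracketPow (p ^ n)) (a := r)).mp hrJ)
  let φ : CharacterModule (FrobAlg R p n) :=
    ψ.comp (Ideal.Quotient.mk (J.bracketPow (p ^ n))).toAddMonoidHom
  have hφ : ∀ a ∈ J, a • φ = 0 := by
    intro a ha
    ext x
    change φ (a • x) = 0
    rw [Algebra.smul_def, FrobAlg.algebraMap_eq]
    have h : a ^ p ^ n * (show R from x) ∈ J.bracketPow (p ^ n) :=
      Ideal.mul_mem_right _ _ (Ideal.subset_span ⟨a, ha, rfl⟩)
    exact (congrArg ψ (Ideal.Quotient.eq_zero_iff_mem.mpr h)).trans (map_zero ψ)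
  let i : (R ⧸ J) →ₗ[R] (T → E) :=
    J.liftQ (LinearMap.toSpanSingleton R (T → E) fun e ↦ e.1) fun a ha ↦
      funext fun e ↦ hT e e.2 a ha
  have hi : Function.Injective i := by
    rw [← LinearMap.ker_eq_bot]
    exact Submodule.ker_liftQ_eq_bot _ _ _ fun s hs ↦ hTJ s fun e he ↦ congrFun hs ⟨e, he⟩
  let f : (R ⧸ J) →ₗ[R] CharacterModule (FrobAlg R p n) :=
    J.liftQ (LinearMap.toSpanSingleton R _ φ) hφ
  have htors : ∀ m : T → E, ∃ k : ℕ, ∀ r ∈ maximalIdeal R ^ k, r • m = 0 := by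
    intro m
    choose κ hκ using fun e ↦ exists_pow_smul_eq_zero_of_essential ι hess (m e)
    exact ⟨Finset.univ.sup κ, fun r hr ↦ funext fun e ↦
      hκ e r (Ideal.pow_le_pow_right (Finset.le_sup (Finset.mem_univ e)) hr)⟩
  obtain ⟨g, hg⟩ := FrobAlg.exists_extension_characterModule hreg n htors i hi f
  have hg1 : g (fun e ↦ e.1) = φ := by
    have := hg (Submodule.Quotient.mk 1)
    change g ((1 : R) • _) = (1 : R) • φ at this
    rwa [one_smul, one_smul] at this
  refine hψ ?_
  change φ (FrobAlg.of R p n r) = 0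
  rw [← hg1, ← Finset.univ_sum_single (fun e : T ↦ e.1), map_sum]
  refine (AddMonoidHom.finsetSum_apply _ _ _).trans (Finset.sum_eq_zero fun e _ ↦ ?_)
  exact FrobBC.apply_eq_zero_of_tmul_eq_zero (g ∘ₗ LinearMap.single R (fun _ : T ↦ E) e)
    (hr e.1 (hT e.1 e.2))

lemma Ideal.bracketPow_sup_le {R : Type u} [CommRing R] {p : ℕ} [Fact p.Prime] [CharP R p]
    (I J : Ideal R) (n : ℕ) : (I ⊔ J).bracketPow (p ^ n) ≤ I.bracketPow (p ^ n) ⊔ J := by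
  refine Ideal.span_le.mpr ?_
  rintro _ ⟨x, hx, rfl⟩
  obtain ⟨a, ha, b, hb, rfl⟩ := Submodule.mem_sup.mp hx
  change (a + b) ^ p ^ n ∈ _
  rw [add_pow_char_pow]
  exact add_mem (Ideal.mem_sup_left (Ideal.subset_span ⟨a, ha, rfl⟩))
    (Ideal.mem_sup_right (Ideal.pow_mem_of_mem _ hb _ (pow_pos (Fact.out : p.Prime).pos n)))

/-- Krull's intersection theorem: ideals of a Noetherian local ring are closed. -/
lemma IsLocalRing.mem_of_forall_mem_sup_pow {R : Type u} [CommRing R] [IsNoetherianRing R]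
    [IsLocalRing R] {I : Ideal R} {r : R} (h : ∀ k : ℕ, r ∈ I ⊔ maximalIdeal R ^ (k + 1)) :
    r ∈ I := by
  have h1 := Ideal.iInf_pow_smul_eq_bot_of_isLocalRing (M := R ⧸ I) (maximalIdeal R)
    Ideal.IsPrime.ne_top'
  have h2 : (Submodule.Quotient.mk r : R ⧸ I) ∈
      (⨅ k : ℕ, maximalIdeal R ^ k • ⊤ : Submodule R (R ⧸ I)) := by
    refine (Submodule.mem_iInf _).mpr fun k ↦ ?_
    obtain ⟨a, ha, b, hb, rfl⟩ := Submodule.mem_sup.mp (h k)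
    rw [Submodule.Quotient.mk_add, (Submodule.Quotient.mk_eq_zero I).mpr ha, zero_add]
    have := Submodule.smul_mem_smul (Ideal.pow_le_pow_right k.le_succ hb)
      (Submodule.mem_top (R := R) (x := (Submodule.Quotient.mk 1 : R ⧸ I)))
    rwa [← Submodule.Quotient.mk_smul, smul_eq_mul, mul_one] at this
  rw [h1] at h2
  exact (Submodule.Quotient.mk_eq_zero I).mp h2

lemma Submodule.annihilator_ideal_smul {R M : Type*} [CommRing R] [AddCommGroup M] [Module R M]
    (I : Ideal R) (N : Submodule R M) :
    (I • N).annihilator = N.annihilator.colon (I : Set R) := by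
  ext s
  rw [Submodule.mem_colon, Submodule.mem_annihilator]
  refine ⟨fun h b hb ↦ Submodule.mem_annihilator.mpr fun x hx ↦ ?_, fun h x hx ↦ ?_⟩
  · rw [smul_assoc]
    exact h _ (Submodule.smul_mem_smul hb hx)
  · induction hx using Submodule.smul_induction_on' with
    | smul b hb x hx => rw [← smul_assoc]; exact Submodule.mem_annihilator.mp (h b hb) x hx
    | add x _ y _ hx hy => rw [smul_add, hx, hy, add_zero]

end

theorem annihilators_of_image_of_torsion_base_change
    (S : Type u) [CommRing S] [IsNoetherianRing S] [IsLocalRing S]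
    (p : ℕ) [Fact p.Prime] [CharP S p]
    (hreg : IsRegularLocal S) (hcomplete : IsAdicComplete (maximalIdeal S) S)
    (ES : Type u) [AddCommGroup ES] [Module S ES] (hES : Module.Injective S ES)
    (ι : (S ⧸ maximalIdeal S) →ₗ[S] ES) (hι : Function.Injective ι)
    (hess : ∀ N : Submodule S ES, N ⊓ LinearMap.range ι = ⊥ → N = ⊥)
    (𝔅 : Ideal S) (h0 : 𝔅 ≠ ⊥) (h1 : 𝔅 ≠ ⊤) (n : ℕ) (hn : 1 ≤ n)
    (K : Submodule S (FrobBC S p n ES))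
    (hK : K = Submodule.span S {x : FrobBC S p n ES |
      ∃ a : S, ∃ e ∈ Submodule.torsionBySet S ES (𝔅 : Set S), x = FrobBC.tmul S p n a e}) :
    K.annihilator = Ideal.bracketPow 𝔅 (p ^ n) ∧
      (𝔅 • K).annihilator = Submodule.colon (Ideal.bracketPow 𝔅 (p ^ n)) 𝔅 := by
  have key : K.annihilator = Ideal.bracketPow 𝔅 (p ^ n) := by
    subst hK
    refine le_antisymm (fun r hr ↦ mem_of_forall_mem_sup_pow fun k ↦ ?_) fun r hr ↦ ?_
    · have hJ : 𝔅 ⊔ maximalIdeal S ^ (k + 1) ≠ ⊤ := ne_top_of_le_ne_top Ideal.IsPrime.ne_top'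
        (sup_le (le_maximalIdeal h1) (Ideal.pow_le_self k.succ_ne_zero))
      refine Ideal.bracketPow_sup_le 𝔅 (maximalIdeal S ^ (k + 1)) n
        (mem_bracketPow_of_forall_tmul_eq_zero hreg hES ι hι hess hJ le_sup_right n r fun e he ↦ ?_)
      have := Submodule.mem_annihilator.mp hr (FrobBC.tmul S p n 1 e) (Submodule.subset_span
        ⟨1, e, (Submodule.mem_torsionBySet_iff _ _).mpr
          fun a ↦ he a (Ideal.mem_sup_left a.2), rfl⟩)
      rwa [FrobBC.smul_tmul, mul_one] at this
    · rw [Submodule.mem_annihilator_span]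
      rintro ⟨_, a, e, he, rfl⟩
      exact FrobBC.smul_tmul_eq_zero_of_mem_bracketPow
        (fun b hb ↦ (Submodule.mem_torsionBySet_iff _ _).mp he ⟨b, hb⟩) hr
  exact ⟨key, by rw [Submodule.annihilator_ideal_smul, key]⟩
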